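/- Assume α = (β+1)/2, 0 < β ≤ 1, and 0 < γ < 1 (region F₁₄). Then there exist M > 0 and functions λ₁, λ₃ : ℝ → ℂ such that for every μ > M, λ₁(μ), its complex conjugate, λ₃(μ), and its complex conjugate are roots of f(·, μ), and as μ → ∞: Re λ₁(μ) = −(1/2)μ^(γ−1)(1+o(1)), Im λ₁(μ) = μ^((β−γ+1)/2)(1+o(1)), Re λ₃(μ) = −(1/2)(1+o(1)), and Im λ₃(μ) = (√7/2)(1+o(1)). -/

import Mathlib

open Filter Real Topology

/-- Characteristic polynomial of the thermoelastic system with Cattaneo's law,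
with inertial coefficient `m = 1`, wave speed `σ = 2`, relaxation `τ = 1`:
`f(λ, μ) = (μ^γ+1)λ⁴ + (μ^γ+1)λ³ + (μ^(2α)+μ^(β+γ)+2μ+μ^β)λ² + (μ^(2α)+2μ)λ + 2μ^(1+β)`. -/
noncomputable def charPoly (α β γ μ : ℝ) (l : ℂ) : ℂ :=
  ((μ ^ γ + 1 : ℝ) : ℂ) * l ^ 4 + ((μ ^ γ + 1 : ℝ) : ℂ) * l ^ 3 +
    ((μ ^ (2 * α) + μ ^ (β + γ) + 2 * μ + μ ^ β : ℝ) : ℂ) * l ^ 2 +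
    ((μ ^ (2 * α) + 2 * μ : ℝ) : ℂ) * l + ((2 * μ ^ (1 + β) : ℝ) : ℂ)

/-- The monic quartic `x⁴ + x³ + (B + D) x² + B x + C` splits into two real quadratics
`x² + s x + t` and `x² + (1 - s) x + C / t` with `t` between `B` and `B + D`. -/
theorem exists_quartic_factorization {B C D : ℝ} (hB : 2 < B) (hC : 0 < C) (hCB : C ≤ 2 * B)
    (hD : 2 ≤ D) :
    ∃ s t : ℝ, B ≤ t ∧ t ≤ B + D ∧ 0 ≤ s ∧ s ≤ 1 ∧ s * (t - C / t) = t - B ∧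
      t + C / t + s * (1 - s) = B + D := by
  have hq : ∀ t, B ≤ t → C / t ≤ 2 := fun t ht => by
    rw [div_le_iff₀ (by linarith)]; linarith
  let σ : ℝ → ℝ := fun t => (t - B) / (t - C / t)
  have hσ0 : ∀ t, B ≤ t → 0 ≤ σ t := fun t ht =>
    div_nonneg (by linarith) (by linarith [hq t ht])
  have hσ1 : ∀ t, B ≤ t → σ t ≤ 1 := fun t ht => by
    have := hq t ht
    exact (div_le_one (by linarith)).2 (by linarith)
  have hcont : ContinuousOn (fun t => t + C / t + σ t * (1 - σ t)) (Set.Icc B (B + D)) := by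
    have h1 : ContinuousOn (fun t : ℝ => C / t) (Set.Icc B (B + D)) :=
      continuousOn_const.div continuousOn_id fun t ht => by
        have := ht.1
        exact ne_of_gt (by linarith)
    have h2 : ContinuousOn σ (Set.Icc B (B + D)) :=
      (continuousOn_id.sub continuousOn_const).div (continuousOn_id.sub h1) fun t ht => by
        have := hq t ht.1
        have := ht.1
        exact sub_ne_zero.2 (ne_of_gt (by linarith))
    exact (continuousOn_id.add h1).add (h2.mul (continuousOn_const.sub h2))
  have hmem : B + D ∈ Set.Icc (B + C / B + σ B * (1 - σ B))
      ((B + D) + C / (B + D) + σ (B + D) * (1 - σ (B + D))) := by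
    constructor
    · have : σ B = 0 := by simp [σ]
      rw [this]
      linarith [hq B le_rfl]
    · have h1 := hσ0 (B + D) (by linarith)
      have h2 := hσ1 (B + D) (by linarith)
      have h3 : 0 ≤ C / (B + D) := div_nonneg hC.le (by linarith)
      nlinarith
  obtain ⟨t, ht, hval⟩ := intermediate_value_Icc (by linarith) hcont hmem
  refine ⟨σ t, t, ht.1, ht.2, hσ0 t ht.1, hσ1 t ht.1, ?_, hval⟩
  exact div_mul_cancel₀ _ (by linarith [hq t ht.1, ht.1])

/-- The root with nonnegative imaginary part of `x² + s x + t`, when `s² / 4 ≤ t`. -/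
noncomputable def upperRoot (s t : ℝ) : ℂ := ⟨-s / 2, √(t - s ^ 2 / 4)⟩

theorem upperRoot_quadratic {s t : ℝ} (h : s ^ 2 / 4 ≤ t) :
    upperRoot s t ^ 2 + s * upperRoot s t + t = 0 := by
  have hs := Real.mul_self_sqrt (sub_nonneg.2 h)
  apply Complex.ext
  · simp only [upperRoot, pow_two, Complex.add_re, Complex.mul_re, Complex.ofReal_re,
      Complex.ofReal_im, Complex.zero_re] at hs ⊢
    rw [hs]
    ring
  · simp only [upperRoot, pow_two, Complex.add_im, Complex.mul_im, Complex.ofReal_re,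
      Complex.ofReal_im, Complex.zero_im]
    ring

theorem charPoly_conj (α β γ μ : ℝ) (z : ℂ) :
    charPoly α β γ μ ((starRingEnd ℂ) z) = (starRingEnd ℂ) (charPoly α β γ μ z) := by
  simp only [charPoly, map_add, map_mul, map_pow, Complex.conj_ofReal]

theorem charPoly_roots_F14 (α β γ : ℝ)
    (h1 : α = (β + 1) / 2) (h2 : 0 < β) (h3 : β ≤ 1)
    (h4 : 0 < γ) (h5 : γ < 1) :
    ∃ M > (0 : ℝ), ∃ l1 l3 : ℝ → ℂ,
      (∀ μ > M,
        charPoly α β γ μ (l1 μ) = 0 ∧ charPoly α β γ μ ((starRingEnd ℂ) (l1 μ)) = 0 ∧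
        charPoly α β γ μ (l3 μ) = 0 ∧ charPoly α β γ μ ((starRingEnd ℂ) (l3 μ)) = 0) ∧
      Tendsto (fun μ : ℝ => (l1 μ).re / (-(1 / 2) * μ ^ (γ - 1))) atTop (𝓝 1) ∧
      Tendsto (fun μ : ℝ => (l1 μ).im / (μ ^ ((β - γ + 1) / 2))) atTop (𝓝 1) ∧
      Tendsto (fun μ : ℝ => (l3 μ).re / (-(1 / 2) : ℝ)) atTop (𝓝 1) ∧
      Tendsto (fun μ : ℝ => (l3 μ).im / (Real.sqrt 7 / 2 : ℝ)) atTop (𝓝 1) := by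
  let P : ℝ → ℝ := fun μ => μ ^ γ + 1
  let B : ℝ → ℝ := fun μ => (μ ^ (1 + β) + 2 * μ) / P μ
  let C : ℝ → ℝ := fun μ => 2 * μ ^ (1 + β) / P μ
  let E : ℝ → ℝ := fun μ => μ ^ (1 + β - γ)
  have hpos : ∀ᶠ μ : ℝ in atTop, 0 < μ := eventually_gt_atTop 0
  have hE : Tendsto E atTop atTop := tendsto_rpow_atTop (by linarith)
  have hD : Tendsto (fun μ : ℝ => μ ^ β) atTop atTop := tendsto_rpow_atTop h2
  have hDinv : Tendsto (fun μ : ℝ => μ ^ (-β)) atTop (𝓝 0) := tendsto_rpow_neg_atTop h2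
  have hGinv : Tendsto (fun μ : ℝ => μ ^ (-γ)) atTop (𝓝 0) := tendsto_rpow_neg_atTop h4
  have hS : Tendsto (fun μ : ℝ => μ ^ (γ - 1)) atTop (𝓝 0) := by
    simpa using tendsto_rpow_neg_atTop (sub_pos.2 h5)
  have hBE : Tendsto (fun μ => B μ / E μ) atTop (𝓝 1) := by
    have h : Tendsto (fun μ : ℝ => (1 + 2 * μ ^ (-β)) / (1 + μ ^ (-γ))) atTop (𝓝 1) := by
      have := ((hDinv.const_mul 2).const_add 1).div (hGinv.const_add 1) (by norm_num)
      simp only [mul_zero, add_zero, div_one] at this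
      exact this
    refine h.congr' ?_
    filter_upwards [hpos] with μ hμ
    have hb := rpow_pos_of_pos hμ β
    have hg := rpow_pos_of_pos hμ γ
    simp only [B, E, P, rpow_neg hμ.le, rpow_sub hμ, rpow_add hμ, rpow_one]
    field_simp
  have hCE : Tendsto (fun μ => C μ / E μ) atTop (𝓝 2) := by
    have h : Tendsto (fun μ : ℝ => 2 / (1 + μ ^ (-γ))) atTop (𝓝 2) := by
      have := (tendsto_const_nhds (x := (2 : ℝ))).div (hGinv.const_add 1) (by norm_num)
      simp only [add_zero, div_one] at this
      exact this
    refine h.congr' ?_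
    filter_upwards [hpos] with μ hμ
    have hb := rpow_pos_of_pos hμ β
    have hg := rpow_pos_of_pos hμ γ
    simp only [C, E, P, rpow_neg hμ.le, rpow_sub hμ, rpow_add hμ, rpow_one]
    field_simp
  have hDE : ∀ᶠ μ : ℝ in atTop, μ ^ β / E μ = μ ^ (γ - 1) := by
    filter_upwards [hpos] with μ hμ
    rw [← rpow_sub hμ]
    congr 1
    ring
  have hBtop : Tendsto B atTop atTop := by
    refine (hBE.pos_mul_atTop one_pos hE).congr' ?_
    filter_upwards [hpos] with μ hμ
    exact div_mul_cancel₀ _ (rpow_pos_of_pos hμ _).ne'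
  have hev : ∀ᶠ μ : ℝ in atTop, ∃ s t : ℝ, B μ ≤ t ∧ t ≤ B μ + μ ^ β ∧ 0 ≤ s ∧ s ≤ 1 ∧
      s * (t - C μ / t) = t - B μ ∧ t + C μ / t + s * (1 - s) = B μ + μ ^ β := by
    filter_upwards [hpos, hBtop.eventually_gt_atTop 2, hD.eventually_ge_atTop 2] with μ hμ hB hb
    have hP : 0 < P μ := add_pos (rpow_pos_of_pos hμ _) one_pos
    have hm := rpow_pos_of_pos hμ (1 + β)
    refine exists_quartic_factorization hB (div_pos (by linarith) hP) ?_ hb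
    rw [← mul_div_assoc]
    exact div_le_div_of_nonneg_right (by linarith) hP.le
  obtain ⟨s, t, hst⟩ : ∃ s t : ℝ → ℝ, ∀ᶠ μ : ℝ in atTop,
      B μ ≤ t μ ∧ t μ ≤ B μ + μ ^ β ∧ 0 ≤ s μ ∧ s μ ≤ 1 ∧
      s μ * (t μ - C μ / t μ) = t μ - B μ ∧
      t μ + C μ / t μ + s μ * (1 - s μ) = B μ + μ ^ β := by
    obtain ⟨s, hs⟩ := hev.choice
    obtain ⟨t, ht⟩ := hs.choice
    exact ⟨s, t, ht⟩
  have htE : Tendsto (fun μ => t μ / E μ) atTop (𝓝 1) := by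
    have hupper : Tendsto (fun μ => B μ / E μ + μ ^ (γ - 1)) atTop (𝓝 1) := by
      simpa using hBE.add hS
    refine tendsto_of_tendsto_of_tendsto_of_le_of_le' hBE hupper ?_ ?_
    · filter_upwards [hpos, hst] with μ hμ h
      exact div_le_div_of_nonneg_right h.1 (rpow_pos_of_pos hμ _).le
    · filter_upwards [hpos, hst, hDE] with μ hμ h h'
      rw [← h', ← add_div]
      exact div_le_div_of_nonneg_right h.2.1 (rpow_pos_of_pos hμ _).le
  have hq : Tendsto (fun μ => C μ / t μ) atTop (𝓝 2) := by
    have h := hCE.div htE one_ne_zero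
    rw [div_one] at h
    refine h.congr' ?_
    filter_upwards [hpos] with μ hμ
    exact div_div_div_cancel_right₀ (rpow_pos_of_pos hμ _).ne' _ _
  have hqE : Tendsto (fun μ => (t μ - C μ / t μ) / E μ) atTop (𝓝 1) := by
    simpa [sub_div] using htE.sub (hq.div_atTop hE)
  have hδ : Tendsto (fun μ => (t μ - B μ) / μ ^ β) atTop (𝓝 1) := by
    have hbdd : Tendsto (fun μ : ℝ => 1 - (C μ / t μ + 1) / μ ^ β) atTop (𝓝 1) := by
      simpa using ((hq.add_const 1).div_atTop hD).const_sub 1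
    refine tendsto_of_tendsto_of_tendsto_of_le_of_le' hbdd tendsto_const_nhds ?_ ?_
    · filter_upwards [hpos, hst] with μ hμ ⟨_, _, hs0, hs1, _, h⟩
      have hb := rpow_pos_of_pos hμ β
      rw [one_sub_div hb.ne']
      exact div_le_div_of_nonneg_right (by nlinarith) hb.le
    · filter_upwards [hpos, hst] with μ hμ h
      exact (div_le_one (rpow_pos_of_pos hμ β)).2 (by linarith [h.2.1])
  have hsS : Tendsto (fun μ => s μ / μ ^ (γ - 1)) atTop (𝓝 1) := by
    have h := hδ.div hqE one_ne_zero
    rw [div_one] at h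
    refine h.congr' ?_
    filter_upwards [hpos, hst, hDE, hqE.eventually_ne one_ne_zero] with μ hμ h h' hne
    have hb := rpow_pos_of_pos hμ β
    have he : 0 < E μ := rpow_pos_of_pos hμ _
    have hne' : t μ - C μ / t μ ≠ 0 := by
      intro h0
      exact hne (by rw [h0, zero_div])
    simp only [Pi.div_apply]
    rw [← h', ← h.2.2.2.2.1]
    generalize t μ - C μ / t μ = r at hne'
    field_simp
  have hs0 : Tendsto s atTop (𝓝 0) := by
    have h := hsS.mul hS
    rw [mul_zero] at h
    refine h.congr' ?_
    filter_upwards [hpos] with μ hμ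
    exact div_mul_cancel₀ _ (rpow_pos_of_pos hμ _).ne'
  have htop : Tendsto t atTop atTop :=
    tendsto_atTop_mono' _ (hst.mono fun _ h => h.1) hBtop
  have hdisc : Tendsto (fun μ => C μ / t μ - (1 - s μ) ^ 2 / 4) atTop (𝓝 (7 / 4)) := by
    have h := hq.sub (((hs0.const_sub 1).pow 2).div_const 4)
    norm_num at h
    exact h
  have hroots : ∀ᶠ μ : ℝ in atTop, charPoly α β γ μ (upperRoot (s μ) (t μ)) = 0 ∧
      charPoly α β γ μ (upperRoot (1 - s μ) (C μ / t μ)) = 0 := by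
    filter_upwards [hpos, hst, htop.eventually_ge_atTop 1,
      hdisc.eventually_const_lt (show (0 : ℝ) < 7 / 4 by norm_num)]
      with μ hμ ⟨_, _, hs0, hs1, e1, e2⟩ ht hd
    have hP : 0 < P μ := add_pos (rpow_pos_of_pos hμ _) one_pos
    have hfac : ∀ z : ℂ, charPoly α β γ μ z =
        P μ * ((z ^ 2 + s μ * z + t μ) * (z ^ 2 + (1 - s μ : ℝ) * z + (C μ / t μ : ℝ))) := by
      intro z
      have hPB : P μ * B μ = μ ^ (1 + β) + 2 * μ := mul_div_cancel₀ _ hP.ne'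
      have hPC : P μ * (t μ * (C μ / t μ)) = 2 * μ ^ (1 + β) := by
        rw [mul_div_cancel₀ _ (by linarith), mul_div_cancel₀ _ hP.ne']
      have c2 : μ ^ (2 * α) + μ ^ (β + γ) + 2 * μ + μ ^ β =
          P μ * (t μ + C μ / t μ + s μ * (1 - s μ)) := by
        rw [e2, mul_add, hPB, h1, rpow_add hμ β γ]
        simp only [P]
        ring_nf
      have c1 : μ ^ (2 * α) + 2 * μ = P μ * (s μ * (C μ / t μ) + t μ * (1 - s μ)) := by
        rw [show s μ * (C μ / t μ) + t μ * (1 - s μ) = B μ by linarith, hPB, h1]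
        ring_nf
      rw [charPoly, c2, c1, ← hPC]
      push_cast
      simp only [P]
      push_cast
      ring
    constructor
    · rw [hfac, upperRoot_quadratic (by nlinarith)]
      simp
    · rw [hfac, upperRoot_quadratic (by linarith)]
      simp
  obtain ⟨M, hM⟩ := eventually_atTop.1 hroots
  refine ⟨max M 1, by positivity, fun μ => upperRoot (s μ) (t μ),
    fun μ => upperRoot (1 - s μ) (C μ / t μ), ?_, ?_, ?_, ?_, ?_⟩
  · intro μ hμ
    obtain ⟨ha, hb⟩ := hM μ ((le_max_left M 1).trans hμ.le)
    simp only [charPoly_conj, ha, hb, map_zero, and_self]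
  · refine hsS.congr fun μ => ?_
    rw [show (upperRoot (s μ) (t μ)).re = -(1 / 2) * s μ by simp only [upperRoot]; ring]
    exact (mul_div_mul_left _ _ (by norm_num)).symm
  · have h := (htE.sub (((hs0.pow 2).div_const 4).div_atTop hE)).sqrt
    simp only [sub_zero, Real.sqrt_one] at h
    refine h.congr' ?_
    filter_upwards [hpos] with μ hμ
    have hroot : μ ^ ((β - γ + 1) / 2) = √(E μ) := by
      rw [Real.sqrt_eq_rpow, ← rpow_mul hμ.le]
      congr 1
      ring
    rw [← sub_div, hroot, Real.sqrt_div' _ (rpow_pos_of_pos hμ _).le]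
    rfl
  · have h := (hs0.const_sub 1)
    rw [sub_zero] at h
    refine h.congr fun μ => ?_
    simp only [upperRoot]
    ring
  · have h7 : √(7 / 4 : ℝ) = √7 / 2 := by
      rw [Real.sqrt_div (by norm_num), show (4 : ℝ) = 2 ^ 2 by norm_num,
        Real.sqrt_sq (by norm_num)]
    have h := hdisc.sqrt.div_const (√7 / 2)
    rw [h7, div_self (by positivity)] at h
    exact h
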